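/- Let d ≥ 1, let k, l be nonnegative integers, and let ψ : ℝ^d → ℝ be a C^∞ function. Define f : ℝ^d × ℝ^d → ℝ by f(z,x) := ψ(z ∘ x), where (z ∘ x)^j := z^j x^j. Then for all z, x ∈ ℝ^d: Σ_{i_1,…,i_k, j_1,…,j_l = 1}^d | ∂_{z^{i_1}}⋯∂_{z^{i_k}} ∂_{x^{j_1}}⋯∂_{x^{j_l}} f(z,x) | ≤ Σ_{r=0}^{k∧l} r! · C(k,r) · C(l,r) · ‖z‖_{ℓ∞}^{l−r} · ‖x‖_{ℓ∞}^{k−r} · Σ_{i_1,…,i_{k+l−r} = 1}^d | ∂_{v^{i_1}}⋯∂_{v^{i_{k+l−r}}} ψ(v) |_{v = z ∘ x}, where C(k,r) denotes the binomial coefficient. -/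

import Mathlib

open scoped Topology

section aux
variable {E : Type*} [NormedAddCommGroup E] [NormedSpace ℝ E] {ι : Type*} [Fintype ι]

def Sm (h : E → ℝ) : Prop := ContDiff ℝ (⊤ : ℕ∞) h

noncomputable def DD (v : E) (h : E → ℝ) : E → ℝ := fun p => fderiv ℝ h p v

noncomputable def GG (e : ι → E) : ℕ → ((E → ℝ) → ℝ) → (E → ℝ) → ℝ
  | 0, Φ, h => Φ h
  | n + 1, Φ, h => ∑ b, GG e n Φ (DD (e b) h)

structure Semi (Φ : (E → ℝ) → ℝ) : Prop where
  nonneg : ∀ h, 0 ≤ Φ h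
  add : ∀ h g, Sm h → Sm g → Φ (fun p => h p + g p) ≤ Φ h + Φ g
  smul : ∀ (c : ℝ) h, Sm h → Φ (fun p => c * h p) = |c| * Φ h

lemma Sm.DD {h : E → ℝ} (hh : Sm h) (v : E) : Sm (DD v h) := by
  have h1 : ContDiff ℝ (⊤ : ℕ∞) (fderiv ℝ h) := ContDiff.fderiv_right (m := (⊤ : ℕ∞)) hh (by simp)
  exact h1.clm_apply contDiff_const

lemma Sm.diff {h : E → ℝ} (hh : Sm h) : Differentiable ℝ h :=
  ContDiff.differentiable hh (by simp)

lemma DD_add {h g : E → ℝ} (hh : Sm h) (hg : Sm g) (v : E) :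
    DD v (fun p => h p + g p) = fun p => DD v h p + DD v g p := by
  funext p
  simp only [DD]
  rw [fderiv_fun_add (hh.diff p) (hg.diff p)]; rfl

lemma DD_smul {h : E → ℝ} (hh : Sm h) (c : ℝ) (v : E) :
    DD v (fun p => c * h p) = fun p => c * DD v h p := by
  funext p
  simp only [DD]
  rw [fderiv_const_mul (hh.diff p)]; rfl

lemma DD_lin {h : E → ℝ} (hh : Sm h) (L : E →L[ℝ] ℝ) (v : E) :
    DD v (fun p => L p * h p) = fun p => L p * DD v h p + L v * h p := by
  funext p
  simp only [DD]
  rw [fderiv_fun_mul L.differentiableAt (hh.diff p)]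
  simp [mul_comm]

lemma Sm.lin {h : E → ℝ} (hh : Sm h) (L : E →L[ℝ] ℝ) : Sm (fun p => L p * h p) :=
  ContDiff.mul L.contDiff hh

lemma Sm.smul {h : E → ℝ} (hh : Sm h) (c : ℝ) : Sm (fun p => c * h p) :=
  ContDiff.mul contDiff_const hh

lemma DD_comm {h : E → ℝ} (hh : Sm h) (v w : E) : DD v (DD w h) = DD w (DD v h) := by
  funext p
  have h1 : ContDiff ℝ (⊤ : ℕ∞) (fderiv ℝ h) := ContDiff.fderiv_right (m := (⊤ : ℕ∞)) hh (by simp)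
  have h2 : DifferentiableAt ℝ (fderiv ℝ h) p := h1.differentiable (by simp) p
  have key : ∀ a b : E, DD a (DD b h) p = fderiv ℝ (fderiv ℝ h) p a b := by
    intro a b
    change fderiv ℝ (fun y => fderiv ℝ h y b) p a = _
    rw [fderiv_clm_apply h2 (differentiableAt_const _)]
    simp
  rw [key, key]
  have : IsSymmSndFDerivAt ℝ h p := by
    apply ContDiffAt.isSymmSndFDerivAt (n := (⊤ : ℕ∞)) hh.contDiffAt
    simp only [minSmoothness_of_isRCLikeNormedField]
    exact WithTop.coe_le_coe.2 (le_top (a := (2 : ℕ∞)))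
  exact this.eq v w

lemma GG_semi (e : ι → E) (n : ℕ) {Φ : (E → ℝ) → ℝ} (hΦ : Semi Φ) : Semi (GG e n Φ) := by
  induction n with
  | zero => exact hΦ
  | succ n ih =>
    refine ⟨fun h => Finset.sum_nonneg fun b _ => ih.nonneg _, fun h g hh hg => ?_, fun c h hh => ?_⟩
    · simp only [GG]
      rw [← Finset.sum_add_distrib]
      refine Finset.sum_le_sum fun b _ => ?_
      rw [DD_add hh hg]
      exact ih.add _ _ (hh.DD _) (hg.DD _)
    · simp only [GG]
      rw [Finset.mul_sum]
      refine Finset.sum_congr rfl fun b _ => ?_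
      rw [DD_smul hh]
      exact ih.smul _ _ (hh.DD _)

lemma GG_swap {κ : Type*} [Fintype κ] (e : ι → E) (n : ℕ) (Ψ : (E → ℝ) → ℝ) (e' : κ → E) (h : E → ℝ) (hh : Sm h) :
    GG e n (GG e' 1 Ψ) h = ∑ b, GG e n Ψ (DD (e' b) h) := by
  induction n generalizing h with
  | zero => rfl
  | succ n ih =>
    have : GG e (n+1) (GG e' 1 Ψ) h = ∑ a, GG e n (GG e' 1 Ψ) (DD (e a) h) := rfl
    have h2 : ∀ b, GG e (n+1) Ψ (DD (e' b) h) = ∑ a, GG e n Ψ (DD (e a) (DD (e' b) h)) := fun _ => rfl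
    rw [this]
    simp only [h2]
    rw [Finset.sum_comm]
    refine Finset.sum_congr rfl fun a _ => ?_
    rw [ih _ (hh.DD _)]
    refine Finset.sum_congr rfl fun b _ => ?_
    rw [DD_comm hh]

lemma GG_one_comp (e' : ι → E) (k : ℕ) (Ψ : (E → ℝ) → ℝ) :
    GG e' (k+1) Ψ = GG e' 1 (GG e' k Ψ) := rfl

lemma GG_lin_zero (e : ι → E) (n : ℕ) (Φ : (E → ℝ) → ℝ) (L : E →L[ℝ] ℝ) (c : ℝ)
    (hL : ∀ b, L (e b) = 0) (hΦ : ∀ h, Sm h → Φ (fun p => L p * h p) = c * Φ h) (h : E → ℝ) (hh : Sm h) :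
    GG e n Φ (fun p => L p * h p) = c * GG e n Φ h := by
  induction n generalizing h with
  | zero => exact hΦ h hh
  | succ n ih =>
    simp only [GG]
    rw [Finset.mul_sum]
    refine Finset.sum_congr rfl fun b _ => ?_
    rw [DD_lin hh, hL]
    simp only [zero_mul, add_zero]
    exact ih _ (hh.DD _)

lemma GG_lin (e : ι → E) (n : ℕ) {Φ : (E → ℝ) → ℝ} (hs : Semi Φ) (L : E →L[ℝ] ℝ) (c : ℝ)
    (hL : ∑ b, |L (e b)| ≤ 1)
    (hΦ : ∀ h, Sm h → Φ (fun p => L p * h p) = c * Φ h) (h : E → ℝ) (hh : Sm h) :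
    GG e n Φ (fun p => L p * h p) ≤ c * GG e n Φ h + n * GG e (n-1) Φ h := by
  induction n generalizing h with
  | zero => simp [GG, hΦ h hh]
  | succ n ih =>
    have h1 : ∀ b, GG e n Φ (DD (e b) (fun p => L p * h p)) ≤
        c * GG e n Φ (DD (e b) h) + n * GG e (n-1) Φ (DD (e b) h) + |L (e b)| * GG e n Φ h := by
      intro b
      rw [DD_lin hh]
      refine ((GG_semi e n hs).add _ _ ((hh.DD _).lin L) (hh.smul _)).trans ?_
      rw [(GG_semi e n hs).smul _ _ hh]
      have := ih _ (hh.DD (e b))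
      linarith
    have h2 : (n:ℝ) * ∑ b, GG e (n-1) Φ (DD (e b) h) = n * GG e n Φ h := by
      cases n with
      | zero => simp
      | succ m => rfl
    calc GG e (n+1) Φ (fun p => L p * h p) ≤ ∑ b, (c * GG e n Φ (DD (e b) h) + n * GG e (n-1) Φ (DD (e b) h) + |L (e b)| * GG e n Φ h) :=
          Finset.sum_le_sum fun b _ => h1 b
      _ = c * GG e (n+1) Φ h + n * GG e n Φ h + (∑ b, |L (e b)|) * GG e n Φ h := by
          rw [Finset.sum_add_distrib, Finset.sum_add_distrib, ← Finset.mul_sum, ← Finset.mul_sum, h2, ← Finset.sum_mul]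
          rfl
      _ ≤ _ := by
          have := mul_le_mul_of_nonneg_right hL ((GG_semi e n hs).nonneg h)
          simp only [Nat.add_sub_cancel]
          push_cast
          linarith

lemma iter_snoc {h : E → ℝ} (hh : Sm h) (n : ℕ) (p : E) (m : Fin n → E) (w : E) :
    iteratedFDeriv ℝ (n+1) h p (Fin.snoc (α := fun _ => E) m w) = iteratedFDeriv ℝ n (DD w h) p m := by
  have h1 : ContDiff ℝ (⊤ : ℕ∞) (fderiv ℝ h) := ContDiff.fderiv_right (m := (⊤ : ℕ∞)) hh (by simp)
  rw [iteratedFDeriv_succ_apply_right, Fin.init_snoc, Fin.snoc_last]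
  have : DD w h = (ContinuousLinearMap.apply ℝ ℝ w) ∘ fderiv ℝ h := rfl
  rw [this, ContinuousLinearMap.iteratedFDeriv_comp_left (n := (⊤ : ℕ∞)) _ h1.contDiffAt (by exact_mod_cast le_top)]
  rfl

lemma sum_snoc (n : ℕ) (F : (Fin (n+1) → ι) → ℝ) :
    ∑ v, F v = ∑ b, ∑ v : Fin n → ι, F (Fin.snoc (α := fun _ => ι) v b) := by
  rw [← (Fin.snocEquiv (fun _ : Fin (n+1) => ι)).sum_comp, Fintype.sum_prod_type]
  rfl

lemma snoc_comp (e : ι → E) (n : ℕ) (v : Fin n → ι) (b : ι) :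
    (fun t => e (Fin.snoc (α := fun _ => ι) v b t)) = Fin.snoc (α := fun _ => E) (fun t => e (v t)) (e b) := by
  funext t
  refine Fin.lastCases ?_ (fun t => ?_) t <;> simp

lemma GG_iter (e : ι → E) (n : ℕ) (p : E) (h : E → ℝ) (hh : Sm h) :
    ∑ v : Fin n → ι, |iteratedFDeriv ℝ n h p (fun t => e (v t))| = GG e n (fun g => |g p|) h := by
  induction n generalizing h with
  | zero => simp [GG]
  | succ n ih =>
    rw [sum_snoc]
    simp only [GG]
    refine Finset.sum_congr rfl fun b _ => ?_
    rw [← ih _ (hh.DD _)]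
    refine Finset.sum_congr rfl fun v _ => ?_
    rw [snoc_comp, iter_snoc hh]

lemma GG_iter2 {κ : Type*} [Fintype κ] (e : ι → E) (e' : κ → E) (k l : ℕ) (p : E) (h : E → ℝ) (hh : Sm h) :
    ∑ i : Fin k → ι, ∑ j : Fin l → κ,
      |iteratedFDeriv ℝ (k + l) h p (Fin.append (fun t => e (i t)) (fun t => e' (j t)))| =
    GG e' l (GG e k (fun g => |g p|)) h := by
  induction l generalizing h with
  | zero =>
    simp only [GG]
    rw [← GG_iter e k p h hh]
    refine Finset.sum_congr rfl fun i _ => ?_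
    simp only [Finset.univ_unique, Finset.sum_singleton]
    congr 2
    funext t
    exact Fin.append_left _ (fun t : Fin 0 => e' ((default : Fin 0 → κ) t)) t
  | succ l ih =>
    rw [Finset.sum_comm, sum_snoc]
    simp only [GG]
    refine Finset.sum_congr rfl fun b _ => ?_
    rw [← ih _ (hh.DD _), Finset.sum_comm]
    refine Finset.sum_congr rfl fun i _ => ?_
    refine Finset.sum_congr rfl fun v _ => ?_
    rw [snoc_comp, Fin.append_snoc]
    congr 1
    exact iter_snoc hh _ _ _ _

end aux

lemma comb (k l : ℕ) (X Z : ℝ) (N : ℕ → ℝ) :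
    X * (∑ r ∈ Finset.range (k+1), (r.factorial : ℝ) * (k.choose r : ℝ) * (l.choose r : ℝ) *
        Z ^ (l - r) * X ^ (k - r) * N (k + l - r + 1)) +
    l * (∑ r ∈ Finset.range (k+1), (r.factorial : ℝ) * (k.choose r : ℝ) * ((l-1).choose r : ℝ) *
        Z ^ (l - 1 - r) * X ^ (k - r) * N (k + (l-1) - r + 1)) =
    ∑ r ∈ Finset.range (k+1+1), (r.factorial : ℝ) * ((k+1).choose r : ℝ) * (l.choose r : ℝ) *
        Z ^ (l - r) * X ^ (k + 1 - r) * N (k + 1 + l - r) := by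
  have e1 : X * (∑ r ∈ Finset.range (k+1), (r.factorial : ℝ) * (k.choose r : ℝ) * (l.choose r : ℝ) *
        Z ^ (l - r) * X ^ (k - r) * N (k + l - r + 1)) =
      ∑ r ∈ Finset.range (k+1+1), (r.factorial : ℝ) * (k.choose r : ℝ) * (l.choose r : ℝ) *
        Z ^ (l - r) * X ^ (k + 1 - r) * N (k + 1 + l - r) := by
    rw [Finset.sum_range_succ _ (k+1), Nat.choose_succ_self, Finset.mul_sum]
    simp only [Nat.cast_zero, mul_zero, zero_mul, add_zero]
    refine Finset.sum_congr rfl fun r hr => ?_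
    have hr : r ≤ k := by simpa [Nat.lt_succ_iff] using hr
    rw [show k + 1 - r = k - r + 1 by omega, show k + 1 + l - r = k + l - r + 1 by omega, pow_succ]
    ring
  rw [e1, Finset.sum_range_succ' _ (k+1), Finset.sum_range_succ' _ (k+1), add_right_comm]
  congr 1
  · rw [Finset.mul_sum, ← Finset.sum_add_distrib]
    refine Finset.sum_congr rfl fun r hr => ?_
    cases l with
    | zero => simp
    | succ l =>
      rw [show k + (l + 1 - 1) - r + 1 = k + 1 + (l+1) - (r+1) by
        have : r ≤ k := by simpa [Nat.lt_succ_iff] using hr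
        omega]
      have h3 : ((l:ℝ)+1) * (l.choose r : ℝ) = ((l+1).choose (r+1) : ℝ) * ((r:ℝ)+1) := by
        exact_mod_cast Nat.add_one_mul_choose_eq l r
      simp only [Nat.add_sub_cancel, Nat.add_sub_add_right, Nat.factorial_succ, Nat.choose_succ_succ k r]
      push_cast
      linear_combination (r.factorial : ℝ) * (k.choose r) * Z ^ (l - r) * X ^ (k - r) * N (k+1+(l+1)-(r+1)) * h3
  · simp

section main
variable {d : ℕ}

def FF (ψ : (Fin d → ℝ) → ℝ) : (Fin d → ℝ) × (Fin d → ℝ) → ℝ :=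
  fun p => ψ fun a => p.1 a * p.2 a

def ez (i : Fin d) : (Fin d → ℝ) × (Fin d → ℝ) := (Pi.single i (1 : ℝ), 0)
def ex (i : Fin d) : (Fin d → ℝ) × (Fin d → ℝ) := (0, Pi.single i (1 : ℝ))
def ev (i : Fin d) : Fin d → ℝ := Pi.single i (1 : ℝ)

def Lz (a : Fin d) : (Fin d → ℝ) × (Fin d → ℝ) →L[ℝ] ℝ :=
  (ContinuousLinearMap.proj a).comp (ContinuousLinearMap.fst ℝ _ _)
def Lx (a : Fin d) : (Fin d → ℝ) × (Fin d → ℝ) →L[ℝ] ℝ :=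
  (ContinuousLinearMap.proj a).comp (ContinuousLinearMap.snd ℝ _ _)

lemma Sm_FF {ψ : (Fin d → ℝ) → ℝ} (h : Sm ψ) : Sm (FF ψ) := by
  unfold Sm FF at *
  fun_prop

lemma DD_FF {ψ : (Fin d → ℝ) → ℝ} (h : Sm ψ) (w p : (Fin d → ℝ) × (Fin d → ℝ)) :
    DD w (FF ψ) p = fderiv ℝ ψ (fun a => p.1 a * p.2 a) (fun a => p.1 a * w.2 a + p.2 a * w.1 a) := by
  have h1 : HasFDerivAt (fun p : (Fin d → ℝ) × (Fin d → ℝ) => fun a => p.1 a * p.2 a)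
      (ContinuousLinearMap.pi fun a => p.1 a • Lx a + p.2 a • Lz a) p := by
    rw [hasFDerivAt_pi]
    intro a
    exact (Lz a).hasFDerivAt.mul (Lx a).hasFDerivAt
  have h2 : HasFDerivAt (FF ψ) _ p := (h.diff _).hasFDerivAt.comp p h1
  simp only [DD]
  rw [h2.fderiv]
  rfl

lemma DD_FF_z {ψ : (Fin d → ℝ) → ℝ} (h : Sm ψ) (a : Fin d) :
    DD (ez a) (FF ψ) = fun p => Lx a p * FF (DD (ev a) ψ) p := by
  funext p
  rw [DD_FF h]
  have : (fun b => p.1 b * (ez a).2 b + p.2 b * (ez a).1 b) = p.2 a • ev a := by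
    funext b
    by_cases hb : b = a
    · subst hb; simp [ez, ev]
    · simp [ez, ev, hb]
  rw [this, map_smul]; rfl

lemma DD_FF_x {ψ : (Fin d → ℝ) → ℝ} (h : Sm ψ) (a : Fin d) :
    DD (ex a) (FF ψ) = fun p => Lz a p * FF (DD (ev a) ψ) p := by
  funext p
  rw [DD_FF h]
  have : (fun b => p.1 b * (ex a).2 b + p.2 b * (ex a).1 b) = p.1 a • ev a := by
    funext b
    by_cases hb : b = a
    · subst hb; simp [ex, ev]
    · simp [ex, ev, hb]
  rw [this, map_smul]; rfl

lemma semi_abs {E : Type*} [NormedAddCommGroup E] [NormedSpace ℝ E] (p : E) :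
    Semi (fun g : E → ℝ => |g p|) :=
  ⟨fun _ => abs_nonneg _, fun _ _ _ _ => abs_add_le _ _, fun _ _ _ => abs_mul _ _⟩

lemma base (l : ℕ) (ψ : (Fin d → ℝ) → ℝ) (h : Sm ψ) (z x : Fin d → ℝ) :
    GG ex l (fun g => |g (z, x)|) (FF ψ) ≤ ‖z‖ ^ l * GG ev l (fun g => |g (fun a => z a * x a)|) ψ := by
  induction l generalizing ψ with
  | zero => simp [GG, FF]
  | succ l ih =>
    simp only [GG]
    rw [Finset.mul_sum]
    refine Finset.sum_le_sum fun b _ => ?_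
    rw [DD_FF_x h, GG_lin_zero ex l _ (Lz b) |z b| (fun c => by simp [Lz, ex])
      (fun g _ => by simp [abs_mul, Lz]) _ (Sm_FF (h.DD _)), pow_succ', mul_assoc]
    exact mul_le_mul (norm_le_pi_norm z b) (ih _ (h.DD _)) ((GG_semi _ _ (semi_abs _)).nonneg _) (norm_nonneg _)

lemma mainb (k l : ℕ) (ψ : (Fin d → ℝ) → ℝ) (h : Sm ψ) (z x : Fin d → ℝ) :
    GG ex l (GG ez k (fun g => |g (z, x)|)) (FF ψ) ≤
      ∑ r ∈ Finset.range (k+1), (r.factorial : ℝ) * (k.choose r : ℝ) * (l.choose r : ℝ) *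
        ‖z‖ ^ (l - r) * ‖x‖ ^ (k - r) * GG ev (k + l - r) (fun g => |g (fun a => z a * x a)|) ψ := by
  induction k generalizing l ψ with
  | zero =>
    have hb := base l ψ h z x
    change GG ex l (fun g => |g (z, x)|) (FF ψ) ≤ _
    simpa using hb
  | succ k ih =>
    rw [GG_one_comp, GG_swap _ _ _ _ _ (Sm_FF h)]
    have hs := GG_semi (ez (d := d)) k (semi_abs (z, x))
    have step : ∀ a, GG ex l (GG ez k (fun g => |g (z, x)|)) (DD (ez a) (FF ψ)) ≤
        ‖x‖ * GG ex l (GG ez k (fun g => |g (z, x)|)) (FF (DD (ev a) ψ)) +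
        l * GG ex (l-1) (GG ez k (fun g => |g (z, x)|)) (FF (DD (ev a) ψ)) := by
      intro a
      rw [DD_FF_z h]
      refine (GG_lin ex l hs (Lx a) |x a| ?_ ?_ _ (Sm_FF (h.DD _))).trans ?_
      · have : ∀ b, |Lx a (ex b)| = if a = b then 1 else 0 := by
          intro b
          by_cases hb : a = b
          · subst hb; simp [Lx, ex]
          · simp [Lx, ex, hb]
        simp [this]
      · intro g hg
        exact GG_lin_zero ez k _ (Lx a) |x a| (fun c => by simp [Lx, ez])
          (fun g _ => by simp [abs_mul, Lx]) _ hg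
      · gcongr
        · exact (GG_semi _ _ hs).nonneg _
        · exact norm_le_pi_norm x a
    refine (Finset.sum_le_sum fun a _ => (step a).trans
      (add_le_add (mul_le_mul_of_nonneg_left (ih l _ (h.DD _)) (norm_nonneg _))
        (mul_le_mul_of_nonneg_left (ih (l-1) _ (h.DD _)) (Nat.cast_nonneg _)))).trans ?_
    rw [← comb k l ‖x‖ ‖z‖ (fun n => GG ev n (fun g => |g (fun a => z a * x a)|) ψ)]
    rw [Finset.sum_add_distrib, ← Finset.mul_sum, ← Finset.mul_sum, Finset.sum_comm]
    rw [Finset.sum_comm (t := Finset.range (k+1))]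
    simp only [← Finset.mul_sum]
    exact le_rfl

end main

/-- Derivative bound for `f(z,x) = ψ(z ∘ x)` (Hadamard product): the `ℓ¹`-norm of the mixed
derivative array `∂_z^{⊗k} ∂_x^{⊗l} f(z,x)` is bounded by
`∑_{r=0}^{k∧l} r! C(k,r) C(l,r) ‖z‖_{ℓ∞}^{l−r} ‖x‖_{ℓ∞}^{k−r}` times the `ℓ¹`-norm of the
`(k+l−r)`-th derivative array of `ψ` at `z ∘ x`. Iterated partial derivatives are expressed
through iterated Fréchet derivatives evaluated at coordinate directions. -/
theorem stmt9
    (d : ℕ) (hd : 1 ≤ d) (k l : ℕ) (ψ : (Fin d → ℝ) → ℝ)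
    (hψ : ContDiff ℝ (⊤ : ℕ∞) ψ) (z x : Fin d → ℝ) :
    ∑ i : Fin k → Fin d, ∑ j : Fin l → Fin d,
        |iteratedFDeriv ℝ (k + l)
            (fun p : (Fin d → ℝ) × (Fin d → ℝ) => ψ fun a => p.1 a * p.2 a) (z, x)
            (Fin.append
              (fun t => ((Pi.single (i t) (1 : ℝ) : Fin d → ℝ), (0 : Fin d → ℝ)))
              (fun t => ((0 : Fin d → ℝ), (Pi.single (j t) (1 : ℝ) : Fin d → ℝ))))| ≤
      ∑ r ∈ Finset.range (min k l + 1),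
        (r.factorial : ℝ) * (k.choose r : ℝ) * (l.choose r : ℝ) *
          ‖z‖ ^ (l - r) * ‖x‖ ^ (k - r) *
          ∑ v : Fin (k + l - r) → Fin d,
            |iteratedFDeriv ℝ (k + l - r) ψ (fun a => z a * x a)
              (fun t => Pi.single (v t) (1 : ℝ))| := by
  have key := mainb k l ψ hψ z x
  rw [← GG_iter2 ez ex k l (z, x) (FF ψ) (Sm_FF hψ)] at key
  refine key.trans (le_of_eq ?_)
  simp only [← GG_iter ev _ _ ψ hψ]
  symm
  apply Finset.sum_subset
  · intro r hr
    simp only [Finset.mem_range] at *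
    omega
  · intro r hr hr'
    simp only [Finset.mem_range] at *
    rw [Nat.choose_eq_zero_of_lt (show l < r by omega)]
    simp
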